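/- arXiv:1305.1579 — 3 statements merged into one kernel-verified Lean document; each statement's English description precedes it below -/
import Mathlib

section
/- Suppose β < β₁ = e^{−λ_max(A)}. Then the global attractor of the double skew product F_β equals the zero section: ⋂_{n∈ℕ} F_β^n(Θ×𝕋×[0,1]) = Θ×𝕋×{0}. Moreover lim_{n→∞} F^n_{β,θ,α}(r) = 0 for all (θ,α,r) ∈ Θ×𝕋×[0,∞). -/
open Filter MeasureTheory Metric Set
open scoped Topology

noncomputable section

/-- ℝ² with the Euclidean norm. -/
abbrev R2 : Type := EuclideanSpace ℝ (Fin 2)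

/-- Action of a 2×2 real matrix on Euclidean ℝ². -/
def mulVecE (M : Matrix (Fin 2) (Fin 2) ℝ) (v : R2) : R2 :=
  (WithLp.equiv 2 (Fin 2 → ℝ)).symm (M.mulVec ((WithLp.equiv 2 (Fin 2 → ℝ)) v))

/-- Operator norm of a 2×2 real matrix induced by the Euclidean norm on ℝ². -/
def opNorm (M : Matrix (Fin 2) (Fin 2) ℝ) : ℝ :=
  ‖(Matrix.toEuclideanCLM (𝕜 := ℝ) M : R2 →L[ℝ] R2)‖

/-- The cocycle `A_n(θ) = A(γ^{n-1}θ) ⋯ A(θ)`. -/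
def coc {Θ : Type*} (γ : Θ → Θ) (A : Θ → Matrix (Fin 2) (Fin 2) ℝ) :
    ℕ → Θ → Matrix (Fin 2) (Fin 2) ℝ
  | 0, _ => 1
  | n + 1, θ => coc γ A n (γ θ) * A θ

/-- Maximal Lyapunov exponent `λ_max(A) = sup_θ limsup (1/n) log‖A_n(θ)‖`. -/
def lyapMax {Θ : Type*} (γ : Θ → Θ) (A : Θ → Matrix (Fin 2) (Fin 2) ℝ) : ℝ :=
  ⨆ θ : Θ, Filter.limsup (fun n : ℕ => Real.log (opNorm (coc γ A n θ)) / n) Filter.atTop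

/-- The hypotheses on `h`: C² on [0,∞), strictly increasing, strictly concave, bounded,
nonnegative, `h 0 = 0`, `h' 0 = 1`. -/
def GoodH (h : ℝ → ℝ) : Prop :=
  ContDiffOn ℝ 2 h (Set.Ici 0) ∧ StrictMonoOn h (Set.Ici 0) ∧
    StrictConcaveOn ℝ (Set.Ici 0) h ∧ BddAbove (h '' Set.Ici 0) ∧
    (∀ x ∈ Set.Ici (0 : ℝ), 0 ≤ h x) ∧ h 0 = 0 ∧ derivWithin h (Set.Ici 0) 0 = 1

/-- The scaling condition `sup_{x ≥ 0} h(x) ≤ (sup_θ ‖A(θ)‖)⁻¹`. -/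
def Scaled {Θ : Type*} (A : Θ → Matrix (Fin 2) (Fin 2) ℝ) (h : ℝ → ℝ) : Prop :=
  ∀ x ∈ Set.Ici (0 : ℝ), h x ≤ (⨆ θ : Θ, opNorm (A θ))⁻¹

open scoped Classical in
/-- The fibre maps `f_{β,θ}(v) = h(β‖v‖)·A(θ)·v/‖v‖`, `f_{β,θ}(0) = 0`. -/
def fibMap {Θ : Type*} (A : Θ → Matrix (Fin 2) (Fin 2) ℝ) (h : ℝ → ℝ) (β : ℝ)
    (θ : Θ) (v : R2) : R2 :=
  if v = 0 then 0 else (h (β * ‖v‖) / ‖v‖) • mulVecE (A θ) v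

/-- The skew product `f_β(θ,v) = (γθ, f_{β,θ}(v))`. -/
def skewProd {Θ : Type*} (γ : Θ → Θ) (A : Θ → Matrix (Fin 2) (Fin 2) ℝ) (h : ℝ → ℝ)
    (β : ℝ) : Θ × R2 → Θ × R2 :=
  fun p => (γ p.1, fibMap A h β p.1 p.2)

/-- The global attractor `𝒜_β = ⋂_{n∈ℕ} f_β^n(Θ × B̄₁(0))`. -/
def globalAttractor {Θ : Type*} (γ : Θ → Θ) (A : Θ → Matrix (Fin 2) (Fin 2) ℝ)
    (h : ℝ → ℝ) (β : ℝ) : Set (Θ × R2) :=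
  ⋂ n : ℕ, (skewProd γ A h β)^[n] '' (Set.univ ×ˢ Metric.closedBall (0 : R2) 1)

/-- The fibre `𝒜_β(θ) = {x : (θ,x) ∈ 𝒜_β}` of the global attractor. -/
def attractorFib {Θ : Type*} (γ : Θ → Θ) (A : Θ → Matrix (Fin 2) (Fin 2) ℝ)
    (h : ℝ → ℝ) (β : ℝ) (θ : Θ) : Set R2 :=
  {x : R2 | (θ, x) ∈ globalAttractor γ A h β}

/-- `v(α) = (cos 2πα, sin 2πα)ᵗ`. -/
def vFull (α : ℝ) : R2 :=
  (WithLp.equiv 2 (Fin 2 → ℝ)).symm ![Real.cos (2 * Real.pi * α), Real.sin (2 * Real.pi * α)]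

/-- `(cos πα, sin πα)ᵗ`, representing the projective point `α ∈ 𝕋 ≅ ℝP¹`. -/
def vHalf (α : ℝ) : R2 :=
  (WithLp.equiv 2 (Fin 2 → ℝ)).symm ![Real.cos (Real.pi * α), Real.sin (Real.pi * α)]

/-- The projective angle coordinate `p(w) = (1/π)·arg(w) mod 1 ∈ [0,1)` of a nonzero
vector `w ∈ ℝ²`; for `w ≠ 0` this equals `(1/π)·arctan(w₂/w₁) mod 1`. -/
def projAngle (w : R2) : ℝ :=
  Int.fract (Complex.arg (Complex.ofReal (w 0) + Complex.ofReal (w 1) * Complex.I) / Real.pi)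

/-- The projective action `g(θ,α) = (γθ, g_θ(α))` of the cocycle on `Θ × 𝕋`,
where `𝕋` is modelled by the fundamental domain `[0,1) ⊆ ℝ`. -/
def gMap {Θ : Type*} (γ : Θ → Θ) (A : Θ → Matrix (Fin 2) (Fin 2) ℝ) :
    Θ × ℝ → Θ × ℝ :=
  fun p => (γ p.1, projAngle (mulVecE (A p.1) (vHalf p.2)))

/-- `Ω(θ,α) = ‖A(θ)(cos πα, sin πα)ᵗ‖`. -/
def Omega {Θ : Type*} (A : Θ → Matrix (Fin 2) (Fin 2) ℝ) (p : Θ × ℝ) : ℝ :=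
  ‖mulVecE (A p.1) (vHalf p.2)‖

/-- The fibre maps `F_{β,θ,α}(r) = h(βr)·Ω(θ,α)` of the double skew product. -/
def dsFib {Θ : Type*} (A : Θ → Matrix (Fin 2) (Fin 2) ℝ) (h : ℝ → ℝ) (β : ℝ)
    (p : Θ × ℝ) (r : ℝ) : ℝ :=
  h (β * r) * Omega A p

/-- The double skew product `F_β(θ,α,r) = (g(θ,α), h(βr)·Ω(θ,α))` on `Θ × 𝕋 × [0,∞)`. -/
def dsMap {Θ : Type*} (γ : Θ → Θ) (A : Θ → Matrix (Fin 2) (Fin 2) ℝ) (h : ℝ → ℝ)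
    (β : ℝ) : Θ × ℝ × ℝ → Θ × ℝ × ℝ :=
  fun p => ((gMap γ A (p.1, p.2.1)).1, (gMap γ A (p.1, p.2.1)).2, dsFib A h β (p.1, p.2.1) p.2.2)

/-- `Ω_n(θ,α) = ∏_{i=0}^{n-1} Ω(g^i(θ,α))`. -/
def OmegaProd {Θ : Type*} (γ : Θ → Θ) (A : Θ → Matrix (Fin 2) (Fin 2) ℝ) (n : ℕ)
    (p : Θ × ℝ) : ℝ :=
  ∏ i ∈ Finset.range n, Omega A ((gMap γ A)^[i] p)

/-- `Γ(a,b) = inf_{a ≤ x ≤ 1} inf_{0 < q ≤ b} h(qx)/(q·h(x))`. -/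
def GammaH (h : ℝ → ℝ) (a b : ℝ) : ℝ :=
  sInf {y : ℝ | ∃ x ∈ Set.Icc a 1, ∃ q ∈ Set.Ioc (0 : ℝ) b, y = h (q * x) / (q * h x)}

/-- The inverse `g⁻¹(θ,α) = (γ⁻¹θ, projective angle of A(γ⁻¹θ)⁻¹·v(α))` of the
projective action. -/
def gInv {Θ : Type*} (γinv : Θ → Θ) (A : Θ → Matrix (Fin 2) (Fin 2) ℝ) :
    Θ × ℝ → Θ × ℝ :=
  fun p => (γinv p.1, projAngle (mulVecE (A (γinv p.1))⁻¹ (vHalf p.2)))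

/-- `F^n_{β,g^{-n}(θ,α)}(1)`, the pullback iterate defining the upper bounding graph. -/
def pullback1 {Θ : Type*} (γ : Θ → Θ) (γinv : Θ → Θ) (A : Θ → Matrix (Fin 2) (Fin 2) ℝ)
    (h : ℝ → ℝ) (β : ℝ) (n : ℕ) (p : Θ × ℝ) : ℝ :=
  ((dsMap γ A h β)^[n] (((gInv γinv A)^[n] p).1, ((gInv γinv A)^[n] p).2, 1)).2.2

lemma GoodH.le_self {h : ℝ → ℝ} (hh : GoodH h) {x : ℝ} (hx : 0 ≤ x) : h x ≤ x := by
  obtain ⟨hC, -, hconc, -, -, h0, hd⟩ := hh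
  rcases hx.eq_or_lt with rfl | hx
  · exact h0.le
  · have hdiff : DifferentiableWithinAt ℝ h (Set.Ici 0) 0 :=
      (hC.differentiableOn (by norm_num)) 0 (by simp)
    have hs := hconc.concaveOn.slope_le_derivWithin (x := 0) (y := x) (by simp) hx.le hx hdiff
    rw [hd, slope_def_field, h0, sub_zero, sub_zero, div_le_one hx] at hs
    exact hs

lemma mulVecE_eq_toEuclideanCLM (M : Matrix (Fin 2) (Fin 2) ℝ) (v : R2) :
    mulVecE M v = (Matrix.toEuclideanCLM (𝕜 := ℝ) M : R2 →L[ℝ] R2) v := rfl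

lemma mulVecE_smul (M : Matrix (Fin 2) (Fin 2) ℝ) (c : ℝ) (v : R2) :
    mulVecE M (c • v) = c • mulVecE M v := by
  simp only [mulVecE_eq_toEuclideanCLM, map_smul]

lemma mulVecE_mul (M N : Matrix (Fin 2) (Fin 2) ℝ) (v : R2) :
    mulVecE (M * N) v = mulVecE M (mulVecE N v) := by
  simp only [mulVecE_eq_toEuclideanCLM, map_mul]
  rfl

lemma mulVecE_one (v : R2) : mulVecE 1 v = v := by
  simp only [mulVecE_eq_toEuclideanCLM, map_one, one_apply_eq_self]

lemma norm_mulVecE_le (M : Matrix (Fin 2) (Fin 2) ℝ) (v : R2) :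
    ‖mulVecE M v‖ ≤ opNorm M * ‖v‖ :=
  (Matrix.toEuclideanCLM (𝕜 := ℝ) M : R2 →L[ℝ] R2).le_opNorm v

lemma opNorm_nonneg (M : Matrix (Fin 2) (Fin 2) ℝ) : 0 ≤ opNorm M := norm_nonneg _

lemma opNorm_mul_le (M N : Matrix (Fin 2) (Fin 2) ℝ) : opNorm (M * N) ≤ opNorm M * opNorm N := by
  unfold opNorm
  rw [map_mul]
  exact norm_mul_le _ _

lemma opNorm_one : opNorm 1 = 1 := by
  unfold opNorm
  rw [map_one]
  exact norm_one

lemma continuous_opNorm : Continuous opNorm := by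
  have : Continuous (Matrix.toEuclideanCLM (n := Fin 2) (𝕜 := ℝ)) :=
    LinearMap.continuous_of_finiteDimensional
      ((Matrix.toEuclideanCLM (n := Fin 2) (𝕜 := ℝ)).toAlgEquiv.toLinearMap)
  exact continuous_norm.comp this

lemma norm_vHalf (α : ℝ) : ‖vHalf α‖ = 1 := by
  rw [EuclideanSpace.norm_eq]
  simp [vHalf, Fin.sum_univ_two]

lemma projAngle_mem (w : R2) : projAngle w ∈ Set.Ico (0 : ℝ) 1 :=
  ⟨Int.fract_nonneg _, Int.fract_lt_one _⟩

lemma vHalf_add_intCast (α : ℝ) (k : ℤ) :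
    vHalf (α + k) = ((-1 : ℝ) ^ k) • vHalf α := by
  have hc : Real.cos (Real.pi * (α + k)) = (-1) ^ k * Real.cos (Real.pi * α) := by
    rw [mul_add, mul_comm Real.pi (k : ℝ), Real.cos_add_int_mul_pi]
  have hs : Real.sin (Real.pi * (α + k)) = (-1) ^ k * Real.sin (Real.pi * α) := by
    rw [mul_add, mul_comm Real.pi (k : ℝ), Real.sin_add_int_mul_pi]
  ext i
  fin_cases i
  · simpa [vHalf] using hc
  · simpa [vHalf] using hs

lemma norm_smul_vHalf_arg (w : R2) :
    ‖w‖ • vHalf (Complex.arg (Complex.ofReal (w 0) + Complex.ofReal (w 1) * Complex.I) / Real.pi)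
      = w := by
  set z : ℂ := Complex.ofReal (w 0) + Complex.ofReal (w 1) * Complex.I with hz
  have hre : z.re = w 0 := by simp [hz]
  have him : z.im = w 1 := by simp [hz]
  have hn : ‖w‖ = ‖z‖ := by
    rw [EuclideanSpace.norm_eq, Complex.norm_eq_sqrt_sq_add_sq, hre, him]
    simp [Fin.sum_univ_two]
  have hpi : Real.pi * (z.arg / Real.pi) = z.arg := by field_simp
  ext i
  fin_cases i
  · simp [vHalf, hpi, hn, hre]
  · simp [vHalf, hpi, hn, him]

lemma exists_smul_vHalf_projAngle (w : R2) :
    ∃ s : ℝ, |s| = 1 ∧ ‖w‖ • vHalf (projAngle w) = s • w := by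
  set x := Complex.arg (Complex.ofReal (w 0) + Complex.ofReal (w 1) * Complex.I) / Real.pi with hx
  refine ⟨(-1) ^ (-⌊x⌋), by simp [abs_zpow], ?_⟩
  have h1 : projAngle w = x + ((-⌊x⌋ : ℤ) : ℝ) := by
    change Int.fract x = _
    rw [Int.fract]; push_cast; ring
  rw [h1, vHalf_add_intCast, smul_comm, hx, norm_smul_vHalf_arg]

lemma norm_mulVecE_vHalf_projAngle (M : Matrix (Fin 2) (Fin 2) ℝ) (w : R2) :
    ‖w‖ * ‖mulVecE M (vHalf (projAngle w))‖ = ‖mulVecE M w‖ := by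
  obtain ⟨s, hs, h⟩ := exists_smul_vHalf_projAngle w
  have := congrArg (fun v => ‖mulVecE M v‖) h
  simpa [mulVecE_smul, norm_smul, hs] using this

lemma projAngle_smul_vHalf {c α : ℝ} (hc : c ≠ 0) (hα : α ∈ Set.Ico (0 : ℝ) 1) :
    projAngle (c • vHalf α) = α := by
  have hpi := Real.pi_pos
  have hpα : Real.pi * α < Real.pi := by nlinarith [hα.2]
  have hpα0 : 0 ≤ Real.pi * α := mul_nonneg hpi.le hα.1
  have hval : projAngle (c • vHalf α) = Int.fract (Complex.arg
      ((c : ℂ) * (Complex.cos (Real.pi * α : ℝ) + Complex.sin (Real.pi * α : ℝ) * Complex.I))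
        / Real.pi) := by
    unfold projAngle
    congr 3
    simp [vHalf]
    ring
  rw [hval]
  rcases hc.lt_or_gt with hneg | hpos
  · rcases hα.1.eq_or_lt with h0 | h0
    · subst h0
      have : (c : ℂ) * (Complex.cos (Real.pi * 0 : ℝ)
          + Complex.sin (Real.pi * 0 : ℝ) * Complex.I) = (c : ℂ) := by simp
      rw [this, Complex.arg_ofReal_of_neg hneg, div_self hpi.ne']
      exact Int.fract_one
    · have h1 : (c : ℂ) * (Complex.cos (Real.pi * α : ℝ)
          + Complex.sin (Real.pi * α : ℝ) * Complex.I) =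
          ((-c : ℝ) : ℂ) * (Complex.cos (Real.pi * α - Real.pi : ℝ)
            + Complex.sin (Real.pi * α - Real.pi : ℝ) * Complex.I) := by
        have e1 := Real.cos_sub_pi (Real.pi * α)
        have e2 := Real.sin_sub_pi (Real.pi * α)
        rw [← Complex.ofReal_cos, ← Complex.ofReal_sin, ← Complex.ofReal_cos,
          ← Complex.ofReal_sin, e1, e2]
        push_cast
        ring
      rw [h1, Complex.arg_mul_cos_add_sin_mul_I (neg_pos.2 hneg)
        ⟨by nlinarith [mul_pos hpi h0], by linarith⟩]
      have h2 : (Real.pi * α - Real.pi) / Real.pi = α - 1 := by field_simp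
      rw [h2, Int.fract_sub_one, Int.fract_eq_self.2 hα]
  · rw [Complex.arg_mul_cos_add_sin_mul_I hpos ⟨by linarith, hpα.le⟩]
    have h2 : Real.pi * α / Real.pi = α := by field_simp
    rw [h2, Int.fract_eq_self.2 hα]

section Cocycle

variable {Θ : Type*}

lemma coc_add (γ : Θ → Θ) (A : Θ → Matrix (Fin 2) (Fin 2) ℝ) (m n : ℕ) (θ : Θ) :
    coc γ A (n + m) θ = coc γ A n (γ^[m] θ) * coc γ A m θ := by
  induction m generalizing θ with
  | zero => simp [coc]
  | succ m ih =>
    rw [← add_assoc, coc, ih, Function.iterate_succ_apply, coc, mul_assoc]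

lemma opNorm_coc_le_pow {γ : Θ → Θ} {A : Θ → Matrix (Fin 2) (Fin 2) ℝ} {K : ℝ}
    (hK : ∀ θ, opNorm (A θ) ≤ K) (n : ℕ) (θ : Θ) : opNorm (coc γ A n θ) ≤ K ^ n := by
  induction n generalizing θ with
  | zero => simp [coc, opNorm_one]
  | succ n ih =>
    rw [coc, pow_succ]
    exact (opNorm_mul_le _ _).trans
      (mul_le_mul (ih _) (hK θ) (opNorm_nonneg _) ((opNorm_nonneg _).trans (ih θ)))

lemma continuous_coc [TopologicalSpace Θ] {γ : Θ → Θ} (hγ : Continuous γ)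
    {A : Θ → Matrix (Fin 2) (Fin 2) ℝ} (hA : Continuous A) (n : ℕ) : Continuous (coc γ A n) := by
  induction n with
  | zero => exact continuous_const
  | succ n ih => exact (ih.comp hγ).matrix_mul hA

lemma exists_opNorm_le [TopologicalSpace Θ] [CompactSpace Θ]
    {A : Θ → Matrix (Fin 2) (Fin 2) ℝ} (hA : Continuous A) :
    ∃ K, 1 ≤ K ∧ ∀ θ, opNorm (A θ) ≤ K := by
  obtain ⟨K, hK⟩ := isCompact_univ.exists_bound_of_continuousOn
    (continuous_opNorm.comp hA).continuousOn
  exact ⟨max 1 K, le_max_left _ _, fun θ =>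
    (le_abs_self _).trans ((hK θ (Set.mem_univ θ)).trans (le_max_right _ _))⟩

lemma log_opNorm_coc_div_le {γ : Θ → Θ} {A : Θ → Matrix (Fin 2) (Fin 2) ℝ} {K : ℝ}
    (hK1 : 1 ≤ K) (hK : ∀ θ, opNorm (A θ) ≤ K) (n : ℕ) (θ : Θ) :
    Real.log (opNorm (coc γ A n θ)) / n ≤ Real.log K := by
  rcases Nat.eq_zero_or_pos n with rfl | hn
  · simpa using Real.log_nonneg hK1
  rw [div_le_iff₀ (by exact_mod_cast hn), mul_comm, ← Real.log_pow]
  rcases (opNorm_nonneg (coc γ A n θ)).eq_or_lt with h0 | h0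
  · rw [← h0, Real.log_zero]
    exact Real.log_nonneg (one_le_pow₀ hK1)
  · exact Real.log_le_log h0 (opNorm_coc_le_pow hK n θ)

/-- If every exponential growth rate is below `l`, each point has a time at which the cocycle
is dominated by `exp l`. -/
lemma exists_opNorm_coc_lt {γ : Θ → Θ} {A : Θ → Matrix (Fin 2) (Fin 2) ℝ} {K l : ℝ}
    (hK1 : 1 ≤ K) (hK : ∀ θ, opNorm (A θ) ≤ K) (hl : lyapMax γ A < l) (θ : Θ) :
    ∃ n, 0 < n ∧ opNorm (coc γ A n θ) < Real.exp l ^ n := by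
  have hbdd : BddAbove (Set.range fun θ : Θ =>
      Filter.limsup (fun n : ℕ => Real.log (opNorm (coc γ A n θ)) / n) Filter.atTop) := by
    refine ⟨Real.log K, ?_⟩
    rintro _ ⟨θ, rfl⟩
    simp only [Filter.limsup_eq]
    by_cases hb : BddBelow {a : ℝ | ∀ᶠ n : ℕ in Filter.atTop,
        Real.log (opNorm (coc γ A n θ)) / n ≤ a}
    · exact csInf_le hb (Filter.Eventually.of_forall fun n => log_opNorm_coc_div_le hK1 hK n θ)
    · rw [Real.sInf_of_not_bddBelow hb]
      exact Real.log_nonneg hK1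
  have hlt := (le_ciSup hbdd θ).trans_lt hl
  have hev := Filter.eventually_lt_of_limsup_lt hlt
    ⟨Real.log K, by
      simpa using ⟨0, fun n _ => log_opNorm_coc_div_le (γ := γ) hK1 hK n θ⟩⟩
  obtain ⟨n, hn, hn0⟩ := (hev.and (Filter.eventually_gt_atTop 0)).exists
  refine ⟨n, hn0, ?_⟩
  rcases (opNorm_nonneg (coc γ A n θ)).eq_or_lt with h0 | h0
  · rw [← h0]; positivity
  · rw [div_lt_iff₀ (by exact_mod_cast hn0)] at hn
    rw [← Real.exp_nat_mul, mul_comm, ← Real.log_lt_iff_lt_exp h0]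
    exact hn

/-- Uniform exponential upper bound for the cocycle at any rate above `lyapMax`. -/
lemma exists_opNorm_coc_le [TopologicalSpace Θ] [CompactSpace Θ] {γ : Θ → Θ} (hγ : Continuous γ)
    {A : Θ → Matrix (Fin 2) (Fin 2) ℝ} (hA : Continuous A) {l : ℝ} (hl : lyapMax γ A < l) :
    ∃ C, ∀ n θ, opNorm (coc γ A n θ) ≤ C * Real.exp l ^ n := by
  obtain ⟨K, hK1, hK⟩ := exists_opNorm_le hA
  choose t ht0 ht using exists_opNorm_coc_lt (γ := γ) hK1 hK hl
  let U : ℕ → Set Θ := fun n => {θ | opNorm (coc γ A n θ) < Real.exp l ^ n}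
  have hU : ∀ n, IsOpen (U n) := fun n =>
    isOpen_lt (continuous_opNorm.comp (continuous_coc hγ hA n)) continuous_const
  obtain ⟨s, hs⟩ := isCompact_univ.elim_finite_subcover (fun θ => U (t θ)) (fun θ => hU _)
    (fun θ _ => Set.mem_iUnion.2 ⟨θ, ht θ⟩)
  have hN : ∀ θ, ∃ m, 0 < m ∧ m ≤ s.sup t ∧ opNorm (coc γ A m θ) < Real.exp l ^ m := by
    intro θ
    obtain ⟨i, hi, hθ⟩ := Set.mem_iUnion₂.1 (hs (Set.mem_univ θ))
    exact ⟨t i, ht0 i, Finset.le_sup hi, hθ⟩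
  set N := s.sup t
  set E := Real.exp l
  have hE : 0 < E := Real.exp_pos l
  let Q := max 1 (K / E)
  have hQ : 1 ≤ Q := le_max_left _ _
  refine ⟨Q ^ N, fun n => ?_⟩
  induction n using Nat.strong_induction_on with
  | _ n ih =>
    intro θ
    obtain ⟨m, hm0, hmN, hm⟩ := hN θ
    rcases le_or_gt m n with hmn | hmn
    · obtain ⟨k, rfl⟩ := Nat.exists_eq_add_of_le' hmn
      rw [coc_add, pow_add, ← mul_assoc]
      exact (opNorm_mul_le _ _).trans (mul_le_mul (ih k (by omega) _) hm.le
        (opNorm_nonneg _) (by positivity))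
    · calc opNorm (coc γ A n θ) ≤ K ^ n := opNorm_coc_le_pow hK n θ
        _ = (K / E) ^ n * E ^ n := by rw [div_pow]; field_simp
        _ ≤ Q ^ N * E ^ n := by
          gcongr
          calc (K / E) ^ n ≤ Q ^ n := by gcongr; exact le_max_right _ _
            _ ≤ Q ^ N := pow_le_pow_right₀ hQ (by omega)

lemma dsMap_snd_snd_nonneg {γ : Θ → Θ} {A : Θ → Matrix (Fin 2) (Fin 2) ℝ} {h : ℝ → ℝ}
    (hh : GoodH h) {β : ℝ} (hβ : 0 ≤ β) {p : Θ × ℝ × ℝ} (hp : 0 ≤ p.2.2) :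
    0 ≤ (dsMap γ A h β p).2.2 :=
  mul_nonneg (hh.2.2.2.2.1 _ (mul_nonneg hβ hp)) (norm_nonneg _)

lemma iterate_dsMap_snd_snd_nonneg {γ : Θ → Θ} {A : Θ → Matrix (Fin 2) (Fin 2) ℝ} {h : ℝ → ℝ}
    (hh : GoodH h) {β : ℝ} (hβ : 0 ≤ β) (n : ℕ) {p : Θ × ℝ × ℝ} (hp : 0 ≤ p.2.2) :
    0 ≤ ((dsMap γ A h β)^[n] p).2.2 := by
  induction n generalizing p with
  | zero => exact hp
  | succ n ih => exact ih (dsMap_snd_snd_nonneg hh hβ hp)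

lemma iterate_dsMap_snd_snd_le {γ : Θ → Θ} {A : Θ → Matrix (Fin 2) (Fin 2) ℝ} {h : ℝ → ℝ}
    (hh : GoodH h) {β : ℝ} (hβ : 0 ≤ β) (n : ℕ) {p : Θ × ℝ × ℝ} (hp : 0 ≤ p.2.2) :
    ((dsMap γ A h β)^[n] p).2.2 ≤ β ^ n * ‖mulVecE (coc γ A n p.1) (vHalf p.2.1)‖ * p.2.2 := by
  induction n generalizing p with
  | zero => simp [coc, mulVecE_one, norm_vHalf]
  | succ n ih =>
    rw [Function.iterate_succ_apply]
    refine (ih (dsMap_snd_snd_nonneg hh hβ hp)).trans ?_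
    set w := mulVecE (A p.1) (vHalf p.2.1) with hw
    change β ^ n * ‖mulVecE (coc γ A n (γ p.1)) (vHalf (projAngle w))‖ * (h (β * p.2.2) * ‖w‖) ≤ _
    calc _ ≤ β ^ n * ‖mulVecE (coc γ A n (γ p.1)) (vHalf (projAngle w))‖
            * ((β * p.2.2) * ‖w‖) := by
          gcongr
          exact hh.le_self (mul_nonneg hβ hp)
      _ = β ^ (n + 1) * (‖w‖ * ‖mulVecE (coc γ A n (γ p.1)) (vHalf (projAngle w))‖) * p.2.2 := by
          ring
      _ = _ := by rw [norm_mulVecE_vHalf_projAngle, hw, ← mulVecE_mul, coc]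

lemma exists_projAngle_mulVecE_eq {M : Matrix (Fin 2) (Fin 2) ℝ} (hM : M.det = 1) {α : ℝ}
    (hα : α ∈ Set.Ico (0 : ℝ) 1) :
    ∃ α' ∈ Set.Ico (0 : ℝ) 1, projAngle (mulVecE M (vHalf α')) = α := by
  set w := mulVecE M⁻¹ (vHalf α)
  have hMw : mulVecE M w = vHalf α := by
    rw [← mulVecE_mul, Matrix.mul_nonsing_inv _ (by simp [hM]), mulVecE_one]
  have hw : ‖w‖ ≠ 0 := by
    intro h0
    have h1 := norm_mulVecE_le M w
    rw [hMw, norm_vHalf, h0, mul_zero] at h1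
    linarith
  refine ⟨projAngle w, projAngle_mem w, ?_⟩
  obtain ⟨s, hs, h⟩ := exists_smul_vHalf_projAngle w
  have hs0 : s ≠ 0 := by rintro rfl; simp at hs
  have h2 : vHalf (projAngle w) = (‖w‖⁻¹ * s) • w := by
    rw [mul_smul, ← h, inv_smul_smul₀ hw]
  rw [h2, mulVecE_smul, hMw]
  exact projAngle_smul_vHalf (mul_ne_zero (inv_ne_zero hw) hs0) hα

lemma surjOn_dsMap_zeroSection {γ : Θ → Θ} (hγ : Function.Surjective γ)
    {A : Θ → Matrix (Fin 2) (Fin 2) ℝ} (hdet : ∀ θ, (A θ).det = 1) {h : ℝ → ℝ} (h0 : h 0 = 0)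
    (β : ℝ) :
    Set.SurjOn (dsMap γ A h β) (Set.univ ×ˢ (Set.Ico (0 : ℝ) 1 ×ˢ ({0} : Set ℝ)))
      (Set.univ ×ˢ (Set.Ico (0 : ℝ) 1 ×ˢ ({0} : Set ℝ))) := by
  rintro ⟨θ, α, r⟩ ⟨-, hα, hr⟩
  obtain rfl : r = 0 := hr
  obtain ⟨θ', rfl⟩ := hγ θ
  obtain ⟨α', hα', he⟩ := exists_projAngle_mulVecE_eq (hdet θ') hα
  refine ⟨(θ', α', 0), ⟨Set.mem_univ _, hα', rfl⟩, ?_⟩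
  simp only [dsMap, gMap, dsFib, mul_zero, h0, zero_mul, he]

end Cocycle

/-- If `β < β₁ = e^{-λ_max(A)}`, the global attractor of the double skew
product equals the zero section `Θ×𝕋×{0}` (with `𝕋` modelled by `[0,1) ⊆ ℝ`), and all
forward fibre orbits tend to 0. -/
theorem stmt13 {Θ : Type*} [MetricSpace Θ] [CompactSpace Θ]
    (γ : Θ ≃ₜ Θ)
    (A : Θ → Matrix (Fin 2) (Fin 2) ℝ) (hdet : ∀ θ, (A θ).det = 1) (hA : Continuous A)
    (h : ℝ → ℝ) (hh : GoodH h) (hscale : Scaled A h)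
    (β : ℝ) (hβpos : 0 < β) (hβ : β < Real.exp (-(lyapMax ⇑γ A))) :
    (⋂ n : ℕ, (dsMap ⇑γ A h β)^[n] ''
        (Set.univ ×ˢ (Set.Ico (0 : ℝ) 1 ×ˢ Set.Icc (0 : ℝ) 1))) =
      Set.univ ×ˢ (Set.Ico (0 : ℝ) 1 ×ˢ ({0} : Set ℝ)) ∧
    ∀ θ : Θ, ∀ α ∈ Set.Ico (0 : ℝ) 1, ∀ r : ℝ, 0 ≤ r →
      Filter.Tendsto (fun n : ℕ => ((dsMap ⇑γ A h β)^[n] (θ, α, r)).2.2)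
        Filter.atTop (𝓝 0) := by
  obtain ⟨l, hl, hlβ⟩ : ∃ l, lyapMax ⇑γ A < l ∧ l < -Real.log β :=
    exists_between (by linarith [(Real.log_lt_iff_lt_exp hβpos).2 hβ])
  obtain ⟨C, hC⟩ := exists_opNorm_coc_le γ.continuous hA hl
  have hρ1 : β * Real.exp l < 1 := by
    calc β * Real.exp l < β * Real.exp (-Real.log β) := by gcongr
      _ = 1 := by rw [Real.exp_neg, Real.exp_log hβpos, mul_inv_cancel₀ hβpos.ne']
  have hbound : ∀ (n : ℕ) (p : Θ × ℝ × ℝ), 0 ≤ p.2.2 →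
      ((dsMap ⇑γ A h β)^[n] p).2.2 ≤ C * (β * Real.exp l) ^ n * p.2.2 := by
    intro n p hp
    refine (iterate_dsMap_snd_snd_le hh hβpos.le n hp).trans (mul_le_mul_of_nonneg_right ?_ hp)
    calc β ^ n * ‖mulVecE (coc (⇑γ) A n p.1) (vHalf p.2.1)‖
        ≤ β ^ n * (C * Real.exp l ^ n) := by
          gcongr
          refine (norm_mulVecE_le _ _).trans ?_
          rw [norm_vHalf, mul_one]
          exact hC n p.1
      _ = C * (β * Real.exp l) ^ n := by rw [mul_pow]; ring
  have hlim : ∀ r : ℝ, Tendsto (fun n : ℕ => C * (β * Real.exp l) ^ n * r) atTop (𝓝 0) := by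
    intro r
    simpa using ((tendsto_pow_atTop_nhds_zero_of_lt_one (by positivity) hρ1).const_mul C).mul_const r
  refine ⟨Set.Subset.antisymm ?_ ?_, ?_⟩
  · rintro ⟨θ, α, r⟩ hp
    rw [Set.mem_iInter] at hp
    obtain ⟨_, ⟨-, hα, hr⟩, rfl⟩ := hp 0
    refine ⟨Set.mem_univ _, hα, le_antisymm ?_ hr.1⟩
    have hC0 : 0 ≤ C := by simpa using (opNorm_nonneg _).trans (hC 0 θ)
    refine ge_of_tendsto' (hlim 1) fun n => ?_
    obtain ⟨q, ⟨-, -, hq⟩, he⟩ := hp n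
    have hle := hbound n q hq.1
    rw [he] at hle
    refine hle.trans ?_
    gcongr
    exact hq.2
  · refine Set.subset_iInter fun n => ?_
    refine ((surjOn_dsMap_zeroSection γ.surjective hdet hh.2.2.2.2.2.1 β).iterate n).trans ?_
    refine Set.image_mono (Set.prod_mono le_rfl (Set.prod_mono le_rfl ?_))
    simp
  · intro θ α _ r hr
    exact squeeze_zero (fun n => iterate_dsMap_snd_snd_nonneg hh hβpos.le n hr)
      (fun n => hbound n (θ, α, r) hr) (hlim r)
end
end

section
/- Let h : [0,∞) → [0,∞) be C², strictly increasing, strictly concave, bounded, with h(0) = 0 and h'(0) = 1. For a, b ∈ (0,1] define Γ(a,b) = inf_{a ≤ x ≤ 1} inf_{0 < q ≤ b} h(qx)/(q·h(x)). Then Γ(a,b) ≥ 1, and if b < 1 then Γ(a,b) > 1. -/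
open Filter MeasureTheory Metric Set
open scoped Topology

noncomputable section

/-- A concave function on `[0,∞)` vanishing at `0` satisfies `q·h(y) ≤ h(qy)` for `q ∈ [0,1]`. -/
theorem ConcaveOn.mul_le_map_mul_of_map_zero {h : ℝ → ℝ} (hc : ConcaveOn ℝ (Set.Ici 0) h)
    (h0 : h 0 = 0) {q y : ℝ} (hq : 0 ≤ q) (hq1 : q ≤ 1) (hy : 0 ≤ y) : q * h y ≤ h (q * y) := by
  simpa [h0] using hc.2 (x := 0) (by simp) (y := y) hy (sub_nonneg.2 hq1) hq (by ring)

/-- A strictly concave function on `[0,∞)` vanishing at `0` satisfies `q·h(y) < h(qy)` for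
`q ∈ (0,1)` and `y > 0`. -/
theorem StrictConcaveOn.mul_lt_map_mul_of_map_zero {h : ℝ → ℝ}
    (hc : StrictConcaveOn ℝ (Set.Ici 0) h) (h0 : h 0 = 0) {q y : ℝ} (hq : 0 < q) (hq1 : q < 1)
    (hy : 0 < y) : q * h y < h (q * y) := by
  simpa [h0] using
    hc.2 (x := 0) (by simp) (y := y) hy.le hy.ne (sub_pos.2 hq1) hq (by ring)

/-- A lower bound for `h(bx)/(b·h(x))` on `[a,1]` is a lower bound for `Γ(a,b)`. -/
theorem le_GammaH {h : ℝ → ℝ} (hc : ConcaveOn ℝ (Set.Ici 0) h) (h0 : h 0 = 0)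
    (hpos : ∀ x, 0 < x → 0 < h x) {a b m : ℝ} (ha : a ∈ Set.Ioc (0 : ℝ) 1) (hb : 0 < b)
    (hm : ∀ x ∈ Set.Icc a 1, m ≤ h (b * x) / (b * h x)) : m ≤ GammaH h a b := by
  refine le_csInf ⟨_, a, ⟨le_rfl, ha.2⟩, b, ⟨hb, le_rfl⟩, rfl⟩ ?_
  rintro _ ⟨x, hx, q, ⟨hq, hqb⟩, rfl⟩
  have hx0 : 0 < x := ha.1.trans_le hx.1
  have hhx := hpos x hx0
  refine (hm x hx).trans ?_
  have key := hc.mul_le_map_mul_of_map_zero h0 (q := q / b) (y := b * x) (by positivity)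
    ((div_le_one hb).2 hqb) (by positivity)
  rw [show q / b * (b * x) = q * x by field_simp] at key
  calc h (b * x) / (b * h x) = q / b * h (b * x) / (q * h x) := by field_simp
    _ ≤ h (q * x) / (q * h x) := by gcongr

/-- For `a, b ∈ (0,1]`, `Γ(a,b) ≥ 1`, and `Γ(a,b) > 1` whenever `b < 1`. -/
theorem stmt17 (h : ℝ → ℝ) (hh : GoodH h) (a b : ℝ)
    (ha : a ∈ Set.Ioc (0 : ℝ) 1) (hb : b ∈ Set.Ioc (0 : ℝ) 1) :
    1 ≤ GammaH h a b ∧ (b < 1 → 1 < GammaH h a b) := by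
  obtain ⟨hdiff, hmono, hconc, -, -, h0, -⟩ := hh
  have hpos : ∀ x, 0 < x → 0 < h x := fun x hx => by
    simpa [h0] using hmono (a := 0) (b := x) (by simp) hx.le hx
  have hxpos : ∀ x ∈ Set.Icc a 1, 0 < x := fun x hx => ha.1.trans_le hx.1
  refine ⟨le_GammaH hconc.concaveOn h0 hpos ha hb.1 fun x hx => ?_, fun hb1 => ?_⟩
  · rw [one_le_div (mul_pos hb.1 (hpos x (hxpos x hx)))]
    exact hconc.concaveOn.mul_le_map_mul_of_map_zero h0 hb.1.le hb.2 (hxpos x hx).le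
  · have hcont : ContinuousOn (fun x => h (b * x) / (b * h x)) (Set.Icc a 1) := by
      refine ContinuousOn.div
        (hdiff.continuousOn.comp (by fun_prop) fun x hx => (mul_pos hb.1 (hxpos x hx)).le)
        (continuousOn_const.mul (hdiff.continuousOn.mono fun x hx => (hxpos x hx).le))
        fun x hx => (mul_pos hb.1 (hpos x (hxpos x hx))).ne'
    obtain ⟨c, hc, hmin⟩ := isCompact_Icc.exists_isMinOn ⟨a, le_rfl, ha.2⟩ hcont
    refine lt_of_lt_of_le ?_
      (le_GammaH hconc.concaveOn h0 hpos ha hb.1 fun x hx => isMinOn_iff.1 hmin x hx)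
    rw [one_lt_div (mul_pos hb.1 (hpos c (hxpos c hc)))]
    exact hconc.mul_lt_map_mul_of_map_zero h0 hb.1 hb1 (hxpos c hc)
end
end

section
/- (Forward comparison lemma.) Fix θ ∈ Θ, α, α' ∈ 𝕋 and r, r' > 0, and set (θ_k, α_k, r_k) = F_β^k(θ,α,r), (θ_k, α'_k, r'_k) = F_β^k(θ,α',r'), q_k = r'_k / r_k and q̂_k = min{q_k, 1}. Let k < n, and assume q_{k+1}, …, q_{n−1} ≤ 1 and β·r_j ≤ 1 for j = k+1, …, n−1. Then q_n ≥ q̂_k · (Ω_{n−k}(θ_k, α'_k) / Ω_{n−k}(θ_k, α_k)) · ∏_{j=k+1}^{n−1} Γ(β r_j, q_j), where Ω_n(θ,α) = ∏_{i=0}^{n−1} Ω(g^i(θ,α)). -/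
open Filter MeasureTheory Metric Set
open scoped Topology

noncomputable section

theorem Omega_pos {Θ : Type*} {A : Θ → Matrix (Fin 2) (Fin 2) ℝ}
    (hdet : ∀ θ, (A θ).det = 1) (p : Θ × ℝ) : 0 < Omega A p := by
  refine norm_pos_iff.mpr fun h0 => ?_
  have h1 : (A p.1).mulVec ![Real.cos (Real.pi * p.2), Real.sin (Real.pi * p.2)] = 0 := by
    simpa [mulVecE, vHalf] using h0
  have h2 := Matrix.eq_zero_of_mulVec_eq_zero (by simp [hdet]) h1
  have hc : Real.cos (Real.pi * p.2) = 0 := congrFun h2 0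
  have hs : Real.sin (Real.pi * p.2) = 0 := congrFun h2 1
  simpa [hc, hs] using Real.sin_sq_add_cos_sq (Real.pi * p.2)

theorem OmegaProd_succ {Θ : Type*} (γ : Θ → Θ) (A : Θ → Matrix (Fin 2) (Fin 2) ℝ) (n : ℕ)
    (p : Θ × ℝ) :
    OmegaProd γ A (n + 1) p = OmegaProd γ A n p * Omega A ((gMap γ A)^[n] p) :=
  Finset.prod_range_succ _ _

theorem dsMap_iterate_base {Θ : Type*} (γ : Θ → Θ) (A : Θ → Matrix (Fin 2) (Fin 2) ℝ)
    (h : ℝ → ℝ) (β : ℝ) (θ : Θ) (α r : ℝ) (n : ℕ) :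
    (((dsMap γ A h β)^[n] (θ, α, r)).1, ((dsMap γ A h β)^[n] (θ, α, r)).2.1) =
      (gMap γ A)^[n] (θ, α) := by
  induction n with
  | zero => rfl
  | succ n ih =>
    rw [Function.iterate_succ_apply', Function.iterate_succ_apply', ← ih]
    rfl

theorem dsMap_iterate_succ_radius {Θ : Type*} (γ : Θ → Θ) (A : Θ → Matrix (Fin 2) (Fin 2) ℝ)
    (h : ℝ → ℝ) (β : ℝ) (θ : Θ) (α r : ℝ) (n : ℕ) :
    ((dsMap γ A h β)^[n + 1] (θ, α, r)).2.2 =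
      h (β * ((dsMap γ A h β)^[n] (θ, α, r)).2.2) * Omega A ((gMap γ A)^[n] (θ, α)) := by
  rw [Function.iterate_succ_apply', ← dsMap_iterate_base γ A h β θ α r n]
  rfl

theorem GoodH.pos {h : ℝ → ℝ} (hh : GoodH h) {x : ℝ} (hx : 0 < x) : 0 < h x := by
  obtain ⟨-, hmono, -, -, -, h0, -⟩ := hh
  simpa [h0] using hmono (mem_Ici.mpr le_rfl) (mem_Ici.mpr hx.le) hx

theorem GoodH.mul_le {h : ℝ → ℝ} (hh : GoodH h) {q x : ℝ} (hq : 0 ≤ q) (hq1 : q ≤ 1)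
    (hx : 0 ≤ x) : q * h x ≤ h (q * x) := by
  obtain ⟨-, -, hconc, -, -, h0, -⟩ := hh
  simpa [h0] using hconc.concaveOn.2 (mem_Ici.mpr hx) (mem_Ici.mpr le_rfl) hq
    (sub_nonneg.mpr hq1) (by ring)

theorem GoodH.min_div_mul_le {h : ℝ → ℝ} (hh : GoodH h) {x y : ℝ} (hx : 0 < x) (hy : 0 < y) :
    min (y / x) 1 * h x ≤ h y := by
  have hm : 0 ≤ min (y / x) 1 := le_min (div_pos hy hx).le zero_le_one
  refine (hh.mul_le hm (min_le_right _ _) hx.le).trans ?_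
  refine hh.2.1.monotoneOn (mem_Ici.mpr (mul_nonneg hm hx.le)) (mem_Ici.mpr hy.le) ?_
  calc min (y / x) 1 * x ≤ y / x * x := by gcongr; exact min_le_left _ _
    _ = y := div_mul_cancel₀ _ hx.ne'

theorem GammaH_quotient_nonneg {h : ℝ → ℝ} (hh : GoodH h) {a b y : ℝ} (ha : 0 < a)
    (hy : y ∈ {y : ℝ | ∃ x ∈ Icc a 1, ∃ q ∈ Ioc (0 : ℝ) b, y = h (q * x) / (q * h x)}) :
    0 ≤ y := by
  obtain ⟨x, hx, q, hq, rfl⟩ := hy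
  have hx0 := ha.trans_le hx.1
  exact (div_pos (hh.pos (mul_pos hq.1 hx0)) (mul_pos hq.1 (hh.pos hx0))).le

theorem GammaH_mul_le {h : ℝ → ℝ} (hh : GoodH h) {a q : ℝ} (ha : 0 < a) (ha1 : a ≤ 1)
    (hq : 0 < q) : GammaH h a q * q ≤ h (q * a) / h a := by
  have hle : GammaH h a q ≤ h (q * a) / (q * h a) :=
    csInf_le ⟨0, fun _ hy => GammaH_quotient_nonneg hh ha hy⟩
      ⟨a, ⟨le_rfl, ha1⟩, q, ⟨hq, le_rfl⟩, rfl⟩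
  have hha := hh.pos ha
  calc GammaH h a q * q ≤ h (q * a) / (q * h a) * q := by gcongr
    _ = h (q * a) / h a := by field_simp

theorem GammaH_nonneg {h : ℝ → ℝ} (hh : GoodH h) {a b : ℝ} (ha : 0 < a) : 0 ≤ GammaH h a b :=
  Real.sInf_nonneg fun _ hy => GammaH_quotient_nonneg hh ha hy

theorem dsMap_iterate_radius_pos {Θ : Type*} (γ : Θ → Θ) {A : Θ → Matrix (Fin 2) (Fin 2) ℝ}
    (hdet : ∀ θ, (A θ).det = 1) {h : ℝ → ℝ} (hh : GoodH h) {β : ℝ} (hβ : 0 < β)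
    (θ : Θ) (α : ℝ) {r : ℝ} (hr : 0 < r) (n : ℕ) :
    0 < ((dsMap γ A h β)^[n] (θ, α, r)).2.2 := by
  induction n with
  | zero => exact hr
  | succ n ih =>
    rw [dsMap_iterate_succ_radius]
    exact mul_pos (hh.pos (mul_pos hβ ih)) (Omega_pos hdet _)

/-- Forward comparison lemma: along two orbits of the double skew
product over the same base point, if `q_{k+1},…,q_{n-1} ≤ 1` and `β·r_j ≤ 1` for
`j = k+1,…,n-1`, then
`q_n ≥ q̂_k · Ω_{n-k}(θ_k,α'_k)/Ω_{n-k}(θ_k,α_k) · ∏_{j=k+1}^{n-1} Γ(βr_j, q_j)`. -/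
theorem stmt18 {Θ : Type*} (γ : Θ → Θ)
    (A : Θ → Matrix (Fin 2) (Fin 2) ℝ) (hdet : ∀ θ, (A θ).det = 1)
    (h : ℝ → ℝ) (hh : GoodH h)
    (β : ℝ) (hβ : 0 < β) (θ : Θ) (α α' r r' : ℝ) (hr : 0 < r) (hr' : 0 < r')
    (k n : ℕ) (hkn : k < n)
    (hq : ∀ j : ℕ, k + 1 ≤ j → j ≤ n - 1 →
      ((dsMap γ A h β)^[j] (θ, α', r')).2.2 / ((dsMap γ A h β)^[j] (θ, α, r)).2.2 ≤ 1)
    (hβr : ∀ j : ℕ, k + 1 ≤ j → j ≤ n - 1 →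
      β * ((dsMap γ A h β)^[j] (θ, α, r)).2.2 ≤ 1) :
    min (((dsMap γ A h β)^[k] (θ, α', r')).2.2 / ((dsMap γ A h β)^[k] (θ, α, r)).2.2) 1 *
        (OmegaProd γ A (n - k) ((gMap γ A)^[k] (θ, α')) /
          OmegaProd γ A (n - k) ((gMap γ A)^[k] (θ, α))) *
        ∏ j ∈ Finset.Icc (k + 1) (n - 1),
          GammaH h (β * ((dsMap γ A h β)^[j] (θ, α, r)).2.2)
            (((dsMap γ A h β)^[j] (θ, α', r')).2.2 / ((dsMap γ A h β)^[j] (θ, α, r)).2.2)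
      ≤ ((dsMap γ A h β)^[n] (θ, α', r')).2.2 / ((dsMap γ A h β)^[n] (θ, α, r)).2.2 := by
  have hR := dsMap_iterate_radius_pos γ hdet hh hβ θ α hr
  have hR' := dsMap_iterate_radius_pos γ hdet hh hβ θ α' hr'
  induction n, (show k + 1 ≤ n from hkn) using Nat.le_induction with
  | base =>
    have hΩ := Omega_pos hdet ((gMap γ A)^[k] (θ, α))
    have hΩ' := Omega_pos hdet ((gMap γ A)^[k] (θ, α'))
    rw [dsMap_iterate_succ_radius, dsMap_iterate_succ_radius, mul_div_mul_comm]
    have hc := hh.min_div_mul_le (mul_pos hβ (hR k)) (mul_pos hβ (hR' k))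
    rw [mul_div_mul_left _ _ hβ.ne', ← le_div_iff₀ (hh.pos (mul_pos hβ (hR k)))] at hc
    simp only [OmegaProd, Nat.add_sub_cancel_left, Nat.add_sub_cancel, Finset.prod_range_one,
      Function.iterate_zero, id, Finset.Icc_eq_empty_of_lt (Nat.lt_succ_self k),
      Finset.prod_empty, mul_one]
    gcongr
  | succ n hn ih =>
    specialize ih hn (fun j h1 h2 => hq j h1 (by omega)) (fun j h1 h2 => hβr j h1 (by omega))
    have hx := mul_pos hβ (hR n)
    have hΓ := GammaH_mul_le hh hx (hβr n hn le_rfl) (div_pos (hR' n) (hR n))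
    have hΓ0 := GammaH_nonneg (b := ((dsMap γ A h β)^[n] (θ, α', r')).2.2 /
      ((dsMap γ A h β)^[n] (θ, α, r)).2.2) hh hx
    have hw := div_pos (Omega_pos hdet ((gMap γ A)^[n] (θ, α')))
      (Omega_pos hdet ((gMap γ A)^[n] (θ, α)))
    have hmul : ((dsMap γ A h β)^[n] (θ, α', r')).2.2 / ((dsMap γ A h β)^[n] (θ, α, r)).2.2 *
        (β * ((dsMap γ A h β)^[n] (θ, α, r)).2.2) =
        β * ((dsMap γ A h β)^[n] (θ, α', r')).2.2 := by
      have := (hR n).ne'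
      field_simp
    rw [hmul] at hΓ
    rw [dsMap_iterate_succ_radius, dsMap_iterate_succ_radius, mul_div_mul_comm]
    refine le_trans ?_ (mul_le_mul_of_nonneg_right
      ((mul_le_mul_of_nonneg_left ih hΓ0).trans hΓ) hw.le)
    have hprod (f : ℕ → ℝ) : ∏ j ∈ Finset.Icc (k + 1) (n + 1 - 1), f j =
        (∏ j ∈ Finset.Icc (k + 1) (n - 1), f j) * f n := by
      obtain ⟨m, rfl⟩ : ∃ m, n = m + 1 := ⟨n - 1, by omega⟩
      exact Finset.prod_Icc_succ_top hn f
    rw [hprod, show n + 1 - k = n - k + 1 by omega, OmegaProd_succ, OmegaProd_succ,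
      ← Function.iterate_add_apply, ← Function.iterate_add_apply,
      Nat.sub_add_cancel (show k ≤ n by omega), mul_div_mul_comm]
    apply le_of_eq
    ring
end
end
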